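/- Let M be a small elementary submodel of 𝕄 and p(x) a type over M. Then there is a global extension q(x) of p(x) such that for all tuples b ∈ 𝕄, if c ⊨ q restricted to Mb, then for any tuple a ∈ 𝕄 there is a' ≡_{Mc} a such that tp(a'c/Mb) extends to a canonical coheir of tp(a'c/M) (and tp(a'c/M) = tp(ac/M)). In particular, q(x) is itself a canonical coheir of p(x). -/

import Mathlib

/- Common model-theoretic infrastructure for formalizing
   "NSOP₂ theories are NSOP₁" (arXiv:2206.08512).

   We work with a monster model `𝕄` of a complete theory: a sufficiently
   saturated and strongly homogeneous `L`-structure.  Tuples are functions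
   `α → 𝕄`; sets of formulas with parameters are coded via `FmlP`. -/

open FirstOrder Language

universe u v w

namespace NSOP2Paper

/-- A first-order formula in free variables `α ⊕ Fin n` together with an
`n`-tuple of parameters from `𝕄`. -/
abbrev FmlP (L : FirstOrder.Language.{u, u}) (𝕄 : Type u) (α : Type v) :=
  Σ n : ℕ, L.Formula (α ⊕ Fin n) × (Fin n → 𝕄)

/-- `a ≡_C b` : the tuples `a` and `b` satisfy the same formulas with
parameters from `C`. -/
def EqTpOver (L : FirstOrder.Language.{u, u}) {𝕄 : Type u} [L.Structure 𝕄] (C : Set 𝕄)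
    {α : Type v} (a b : α → 𝕄) : Prop :=
  ∀ (n : ℕ) (φ : L.Formula (α ⊕ Fin n)) (c : Fin n → 𝕄), (∀ i, c i ∈ C) →
    (φ.Realize (Sum.elim a c) ↔ φ.Realize (Sum.elim b c))

/-- `tp(a / C)` is finitely satisfiable in `Ms`: every formula over `C`
satisfied by `a` has a realization by a tuple from `Ms`. -/
def FinSatIn (L : FirstOrder.Language.{u, u}) {𝕄 : Type u} [L.Structure 𝕄] (Ms : Set 𝕄)
    {α : Type v} (a : α → 𝕄) (C : Set 𝕄) : Prop :=
  ∀ (n : ℕ) (φ : L.Formula (α ⊕ Fin n)) (c : Fin n → 𝕄), (∀ i, c i ∈ C) →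
    φ.Realize (Sum.elim a c) →
    ∃ m : α → 𝕄, (∀ i, m i ∈ Ms) ∧ φ.Realize (Sum.elim m c)

/-- `Ms` is the underlying set of a (small) elementary submodel of `𝕄`. -/
def IsElemSubmodel (L : FirstOrder.Language.{u, u}) {𝕄 : Type u} [L.Structure 𝕄] (Ms : Set 𝕄) : Prop :=
  ∃ S : L.ElementarySubstructure 𝕄, (S : Set 𝕄) = Ms

/-- A complete consistent global type (a complete type over the monster `𝕄`)
in variables `α`, coded as the set of formulas-with-parameters it contains. -/
structure GlobalType (L : FirstOrder.Language.{u, u}) (𝕄 : Type u) [L.Structure 𝕄] (α : Type v) where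
  carrier : Set (FmlP L 𝕄 α)
  consistent : ∀ t : Finset (FmlP L 𝕄 α), ↑t ⊆ carrier →
    ∃ a : α → 𝕄, ∀ p ∈ t, p.2.1.Realize (Sum.elim a p.2.2)
  complete : ∀ (n : ℕ) (φ : L.Formula (α ⊕ Fin n)) (c : Fin n → 𝕄),
    (⟨n, (φ, c)⟩ : FmlP L 𝕄 α) ∈ carrier ∨ (⟨n, (φ.not, c)⟩ : FmlP L 𝕄 α) ∈ carrier

variable {L : FirstOrder.Language.{u, u}} {𝕄 : Type u} [L.Structure 𝕄]

/-- The global type `q` is finitely satisfiable in `Ms` (i.e. it is a coheir of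
its restriction to `Ms`). -/
def GlobalType.FinSatInM {α : Type v} (q : GlobalType L 𝕄 α) (Ms : Set 𝕄) : Prop :=
  ∀ t : Finset (FmlP L 𝕄 α), ↑t ⊆ q.carrier →
    ∃ m : α → 𝕄, (∀ i, m i ∈ Ms) ∧ ∀ p ∈ t, p.2.1.Realize (Sum.elim m p.2.2)

/-- `a ⊨ q|_C` : the tuple `a` realizes the restriction of the global type `q`
to parameters from `C`. -/
def RealizesType {α : Type v} (q : GlobalType L 𝕄 α) (a : α → 𝕄) (C : Set 𝕄) : Prop :=
  ∀ (n : ℕ) (φ : L.Formula (α ⊕ Fin n)) (c : Fin n → 𝕄), (∀ i, c i ∈ C) →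
    (⟨n, (φ, c)⟩ : FmlP L 𝕄 α) ∈ q.carrier → φ.Realize (Sum.elim a c)

/-- The global type `q` extends `tp(a / C)`. -/
def ExtendsTpOver {α : Type v} (q : GlobalType L 𝕄 α) (C : Set 𝕄) (a : α → 𝕄) : Prop :=
  ∀ (n : ℕ) (φ : L.Formula (α ⊕ Fin n)) (c : Fin n → 𝕄), (∀ i, c i ∈ C) →
    φ.Realize (Sum.elim a c) → (⟨n, (φ, c)⟩ : FmlP L 𝕄 α) ∈ q.carrier

/-- `B` is a coheir Morley sequence over `Ms` in the global type `q`: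
`q` is finitely satisfiable in `Ms` and `B i ⊨ q|_(Ms ∪ B_{<i})`. -/
def MorleyIn {α : Type v} (q : GlobalType L 𝕄 α) (Ms : Set 𝕄) (B : ℕ → α → 𝕄) : Prop :=
  q.FinSatInM Ms ∧
    ∀ i : ℕ, RealizesType q (B i) (Ms ∪ ⋃ (j : ℕ) (_ : j < i), Set.range (B j))

/-- `B` is a coheir Morley sequence over `Ms`. -/
def CoheirMorley (L : FirstOrder.Language.{u, u}) {𝕄 : Type u} [L.Structure 𝕄] (Ms : Set 𝕄)
    {α : Type v} (B : ℕ → α → 𝕄) : Prop :=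
  ∃ q : GlobalType L 𝕄 α, MorleyIn q Ms B

/-- Flatten an `ℕ`-indexed sequence of `α`-tuples into a single tuple. -/
def flatSeq {α : Type v} (I : ℕ → α → 𝕄) : ℕ × α → 𝕄 := fun p => I p.1 p.2

/-- The sequence `I` is indiscernible over `C`. -/
def IndiscernibleOver (L : FirstOrder.Language.{u, u}) {𝕄 : Type u} [L.Structure 𝕄] (C : Set 𝕄)
    {α : Type v} (I : ℕ → α → 𝕄) : Prop :=
  ∀ (n : ℕ) (f g : Fin n → ℕ), StrictMono f → StrictMono g →
    EqTpOver L C (fun p : Fin n × α => I (f p.1) p.2) (fun p : Fin n × α => I (g p.1) p.2)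

/-- `𝕄` is `κ`-saturated: every finitely satisfiable set of formulas in fewer
than `κ` variables over a parameter set of size `< κ` is realized in `𝕄`. -/
def IsSaturated (L : FirstOrder.Language.{u, u}) (𝕄 : Type u) [L.Structure 𝕄] (κ : Cardinal.{u}) : Prop :=
  ∀ (α : Type u) (A : Set 𝕄), Cardinal.mk α < κ → Cardinal.mk A < κ →
    ∀ Γ : Set (FmlP L 𝕄 α), (∀ p ∈ Γ, ∀ i, p.2.2 i ∈ A) →
      (∀ t : Finset (FmlP L 𝕄 α), ↑t ⊆ Γ →
        ∃ a : α → 𝕄, ∀ p ∈ t, p.2.1.Realize (Sum.elim a p.2.2)) →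
      ∃ a : α → 𝕄, ∀ p ∈ Γ, p.2.1.Realize (Sum.elim a p.2.2)

/-- `𝕄` is strongly `κ`-homogeneous: partial elementary maps between tuples of
length `< κ` extend to automorphisms of `𝕄`. -/
def IsStronglyHomogeneous (L : FirstOrder.Language.{u, u}) (𝕄 : Type u) [L.Structure 𝕄]
    (κ : Cardinal.{u}) : Prop :=
  ∀ (α : Type u), Cardinal.mk α < κ → ∀ a b : α → 𝕄, EqTpOver L (∅ : Set 𝕄) a b →
    ∃ σ : 𝕄 ≃[L] 𝕄, ∀ i, σ (a i) = b i

/-- `𝕄` is a monster model (for smallness degree `κ`): sufficiently saturated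
and strongly homogeneous. -/
def IsMonster (L : FirstOrder.Language.{u, u}) (𝕄 : Type u) [L.Structure 𝕄] (κ : Cardinal.{u}) : Prop :=
  Cardinal.aleph0 < κ ∧ IsSaturated L 𝕄 κ ∧ IsStronglyHomogeneous L 𝕄 κ

/-! ### Tree combinatorics -/

/-- The meet (longest common prefix) of two finite sequences. -/
def meet {A : Type w} [DecidableEq A] : List A → List A → List A
  | a :: as, b :: bs => if a = b then a :: meet as bs else []
  | _, _ => []

/-- The meet of `η 0, …, η i`. -/
def combMeet {A : Type w} [DecidableEq A] {k : ℕ} (η : Fin k → List A) (i : Fin k) : List A :=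
  (List.ofFn fun j : Fin i.val => η (Fin.castLE i.2.le j)).foldl meet (η i)

/-- `η 0, …, η (k-1)` is a descending comb: a lexicographically increasing
antichain such that the meet of `η 0, …, η (i+1)` is a proper initial segment
of the meet of `η 0, …, η i`. -/
def DescendingComb {A : Type w} [DecidableEq A] [LT A] {k : ℕ} (η : Fin k → List A) : Prop :=
  (∀ i j : Fin k, i ≠ j → ¬ η i <+: η j) ∧
  (∀ i j : Fin k, i < j → List.Lex (· < ·) (η i) (η j)) ∧
  (∀ (i : ℕ) (h : i + 1 < k),
    combMeet η ⟨i + 1, h⟩ <+: combMeet η ⟨i, by omega⟩ ∧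
    combMeet η ⟨i + 1, h⟩ ≠ combMeet η ⟨i, by omega⟩)

/-! ### Tree properties of theories (witnessed in the monster model) -/

/-- `T = Th(𝕄)` has `SOP₁`. -/
def HasSOP1 (L : FirstOrder.Language.{u, u}) (𝕄 : Type u) [L.Structure 𝕄] : Prop :=
  ∃ (k m : ℕ) (φ : L.Formula (Fin k ⊕ Fin m)) (b : List Bool → Fin m → 𝕄),
    (∀ σ : ℕ → Bool, ∃ a : Fin k → 𝕄,
      ∀ n : ℕ, φ.Realize (Sum.elim a (b (List.ofFn fun i : Fin n => σ i)))) ∧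
    ∀ η₁ η₂ : List Bool, (η₁ ++ [false]) <+: η₂ →
      ¬ ∃ a : Fin k → 𝕄, φ.Realize (Sum.elim a (b η₂)) ∧
        φ.Realize (Sum.elim a (b (η₁ ++ [true])))

/-- `T = Th(𝕄)` has `SOP₂`. -/
def HasSOP2 (L : FirstOrder.Language.{u, u}) (𝕄 : Type u) [L.Structure 𝕄] : Prop :=
  ∃ (k m : ℕ) (φ : L.Formula (Fin k ⊕ Fin m)) (b : List Bool → Fin m → 𝕄),
    (∀ σ : ℕ → Bool, ∃ a : Fin k → 𝕄,
      ∀ n : ℕ, φ.Realize (Sum.elim a (b (List.ofFn fun i : Fin n => σ i)))) ∧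
    ∀ η₁ η₂ : List Bool, ¬ η₁ <+: η₂ → ¬ η₂ <+: η₁ →
      ¬ ∃ a : Fin k → 𝕄, φ.Realize (Sum.elim a (b η₁)) ∧ φ.Realize (Sum.elim a (b η₂))

/-- `T = Th(𝕄)` has `k`-`DCTP₁`: paths are consistent but descending combs of
size `k` are inconsistent. -/
def HasKDCTP1 (L : FirstOrder.Language.{u, u}) (𝕄 : Type u) [L.Structure 𝕄] (k : ℕ) : Prop :=
  ∃ (r m : ℕ) (φ : L.Formula (Fin r ⊕ Fin m)) (b : List ℕ → Fin m → 𝕄),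
    (∀ σ : ℕ → ℕ, ∃ a : Fin r → 𝕄,
      ∀ n : ℕ, φ.Realize (Sum.elim a (b (List.ofFn fun i : Fin n => σ i)))) ∧
    ∀ η : Fin k → List ℕ, DescendingComb η →
      ¬ ∃ a : Fin r → 𝕄, ∀ i, φ.Realize (Sum.elim a (b (η i)))

/-- `T = Th(𝕄)` has weak `k`-`TP₁`: paths are consistent but any `k` pairwise
incomparable nodes with common pairwise meet are inconsistent. -/
def HasWeakKTP1 (L : FirstOrder.Language.{u, u}) (𝕄 : Type u) [L.Structure 𝕄] (k : ℕ) : Prop :=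
  ∃ (r m : ℕ) (φ : L.Formula (Fin r ⊕ Fin m)) (b : List ℕ → Fin m → 𝕄),
    (∀ σ : ℕ → ℕ, ∃ a : Fin r → 𝕄,
      ∀ n : ℕ, φ.Realize (Sum.elim a (b (List.ofFn fun i : Fin n => σ i)))) ∧
    ∀ η : Fin k → List ℕ,
      (∀ i j, i ≠ j → ¬ η i <+: η j) →
      (∀ i j i' j' : Fin k, i ≠ j → i' ≠ j' → meet (η i) (η j) = meet (η i') (η j')) →
      ¬ ∃ a : Fin r → 𝕄, ∀ i, φ.Realize (Sum.elim a (b (η i)))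

/-- `T = Th(𝕄)` has `k`-`DCTP₂`: paths are `k`-inconsistent but descending
combs are consistent. -/
def HasKDCTP2 (L : FirstOrder.Language.{u, u}) (𝕄 : Type u) [L.Structure 𝕄] (k : ℕ) : Prop :=
  ∃ (r m : ℕ) (φ : L.Formula (Fin r ⊕ Fin m)) (b : List Bool → Fin m → 𝕄),
    (∀ σ : ℕ → Bool, ∀ s : Finset ℕ, s.card = k →
      ¬ ∃ a : Fin r → 𝕄, ∀ n ∈ s,
        φ.Realize (Sum.elim a (b (List.ofFn fun i : Fin n => σ i)))) ∧
    ∀ (l : ℕ) (η : Fin l → List Bool), DescendingComb η →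
      ∃ a : Fin r → 𝕄, ∀ i, φ.Realize (Sum.elim a (b (η i)))

/-! ### Kim-dividing and Conant-dividing, with respect to coheir Morley sequences -/

/-- `φ(x, b)` Kim-divides over `Ms`: some coheir Morley sequence over `Ms`
starting with `b` makes it inconsistent. -/
def KimDivides (L : FirstOrder.Language.{u, u}) {𝕄 : Type u} [L.Structure 𝕄] (Ms : Set 𝕄)
    {α : Type v} {n : ℕ} (φ : L.Formula (α ⊕ Fin n)) (b : Fin n → 𝕄) : Prop :=
  ∃ B : ℕ → Fin n → 𝕄, CoheirMorley L Ms B ∧ B 0 = b ∧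
    ¬ ∃ a : α → 𝕄, ∀ i, φ.Realize (Sum.elim a (B i))

/-- `φ(x, b)` Kim-forks over `Ms`: it implies a finite disjunction of formulas
Kim-dividing over `Ms`. -/
def KimForks (L : FirstOrder.Language.{u, u}) {𝕄 : Type u} [L.Structure 𝕄] (Ms : Set 𝕄)
    {α : Type v} {n : ℕ} (φ : L.Formula (α ⊕ Fin n)) (b : Fin n → 𝕄) : Prop :=
  ∃ (N : ℕ) (m : Fin N → ℕ) (ψ : ∀ j : Fin N, L.Formula (α ⊕ Fin (m j)))
    (c : ∀ j : Fin N, Fin (m j) → 𝕄),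
    (∀ j, KimDivides L Ms (ψ j) (c j)) ∧
    ∀ a : α → 𝕄, φ.Realize (Sum.elim a b) → ∃ j, (ψ j).Realize (Sum.elim a (c j))

/-- `φ(x, b)` Conant-divides over `Ms`: every coheir Morley sequence over `Ms`
starting with `b` makes it inconsistent. -/
def ConantDivides (L : FirstOrder.Language.{u, u}) {𝕄 : Type u} [L.Structure 𝕄] (Ms : Set 𝕄)
    {α : Type v} {n : ℕ} (φ : L.Formula (α ⊕ Fin n)) (b : Fin n → 𝕄) : Prop :=
  ∀ B : ℕ → Fin n → 𝕄, CoheirMorley L Ms B → B 0 = b →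
    ¬ ∃ a : α → 𝕄, ∀ i, φ.Realize (Sum.elim a (B i))

/-- `φ(x, b)` Conant-forks over `Ms`. -/
def ConantForks (L : FirstOrder.Language.{u, u}) {𝕄 : Type u} [L.Structure 𝕄] (Ms : Set 𝕄)
    {α : Type v} {n : ℕ} (φ : L.Formula (α ⊕ Fin n)) (b : Fin n → 𝕄) : Prop :=
  ∃ (N : ℕ) (m : Fin N → ℕ) (ψ : ∀ j : Fin N, L.Formula (α ⊕ Fin (m j)))
    (c : ∀ j : Fin N, Fin (m j) → 𝕄),
    (∀ j, ConantDivides L Ms (ψ j) (c j)) ∧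
    ∀ a : α → 𝕄, φ.Realize (Sum.elim a b) → ∃ j, (ψ j).Realize (Sum.elim a (c j))

/-- `a ⫝^{K*}_{Ms} b` : `tp(a/Ms b)` contains no formula Conant-forking
over `Ms`. -/
def ConantIndep (L : FirstOrder.Language.{u, u}) {𝕄 : Type u} [L.Structure 𝕄] (Ms : Set 𝕄)
    {α : Type v} {β : Type w} (a : α → 𝕄) (b : β → 𝕄) : Prop :=
  ∀ (n : ℕ) (φ : L.Formula (α ⊕ Fin n)) (d : Fin n → 𝕄),
    (∀ i, d i ∈ Ms ∪ Set.range b) → φ.Realize (Sum.elim a d) →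
    ¬ ConantForks L Ms φ d

/-! ### Abstract independence relations between sets over models -/

/-- An abstract ternary relation `A ⫝_M B` between subsets of `𝕄` over
(elementary submodels of) `𝕄`. -/
structure IndRel (L : FirstOrder.Language.{u, u}) (𝕄 : Type u) [L.Structure 𝕄] where
  rel : Set 𝕄 → Set 𝕄 → Set 𝕄 → Prop

/-- A set `S` of `α`-tuples is type-definable over `C`. -/
def TypeDefinableOver (L : FirstOrder.Language.{u, u}) {𝕄 : Type u} [L.Structure 𝕄] (C : Set 𝕄)
    {γ : Type v} (S : Set (γ → 𝕄)) : Prop :=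
  ∃ Γ : Set (FmlP L 𝕄 γ), (∀ p ∈ Γ, ∀ i, p.2.2 i ∈ C) ∧
    ∀ g : γ → 𝕄, g ∈ S ↔ ∀ p ∈ Γ, p.2.1.Realize (Sum.elim g p.2.2)

namespace IndRel


/-- Invariance under automorphisms of `𝕄`. -/
def Invariant (R : IndRel L 𝕄) : Prop :=
  ∀ (σ : 𝕄 ≃[L] 𝕄) (A Ms B : Set 𝕄), R.rel A Ms B →
    R.rel ((⇑σ) '' A) ((⇑σ) '' Ms) ((⇑σ) '' B)

/-- Monotonicity (on both sides). -/
def Mono (R : IndRel L 𝕄) : Prop :=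
  ∀ (A A' Ms B B' : Set 𝕄), IsElemSubmodel L Ms → R.rel A Ms B →
    Ms ⊆ A' → A' ⊆ A → Ms ⊆ B' → B' ⊆ B → R.rel A' Ms B'

/-- Existence: for `M ⊆ A, B` there is `A' ≡_M A` with `A' ⫝_M B`. -/
def Existence (R : IndRel L 𝕄) (κ : Cardinal.{u}) : Prop :=
  ∀ (Ms : Set 𝕄), IsElemSubmodel L Ms → Cardinal.mk Ms < κ →
    ∀ (α β : Type u), Cardinal.mk α < κ → Cardinal.mk β < κ →
      ∀ (a : α → 𝕄) (b : β → 𝕄),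
        ∃ a' : α → 𝕄, EqTpOver L Ms a' a ∧
          R.rel (Ms ∪ Set.range a') Ms (Ms ∪ Set.range b)

/-- Right extension. -/
def RightExt (R : IndRel L 𝕄) (κ : Cardinal.{u}) : Prop :=
  ∀ (Ms : Set 𝕄), IsElemSubmodel L Ms → Cardinal.mk Ms < κ →
    ∀ (α : Type u), Cardinal.mk α < κ → ∀ (a : α → 𝕄) (B C : Set 𝕄),
      Cardinal.mk B < κ → Cardinal.mk C < κ →
      R.rel (Set.range a) Ms B → B ⊆ C →
      ∃ a' : α → 𝕄, EqTpOver L B a' a ∧ R.rel (Set.range a') Ms C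

/-- Quasi-strong finite character: for complete types `p = tp(a₀/Ms)` and
`q = tp(b₀/Ms)`, the set of pairs of realizations `(a, b)` with `a ⫝_Ms b`
is type-definable over `Ms`. -/
def QSFC (R : IndRel L 𝕄) (κ : Cardinal.{u}) : Prop :=
  ∀ (Ms : Set 𝕄), IsElemSubmodel L Ms → Cardinal.mk Ms < κ →
    ∀ (α β : Type u), Cardinal.mk α < κ → Cardinal.mk β < κ →
      ∀ (a₀ : α → 𝕄) (b₀ : β → 𝕄),
        TypeDefinableOver L Ms {g : (α ⊕ β) → 𝕄 |
          EqTpOver L Ms (g ∘ Sum.inl) a₀ ∧ EqTpOver L Ms (g ∘ Sum.inr) b₀ ∧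
          R.rel (Set.range (g ∘ Sum.inl)) Ms (Set.range (g ∘ Sum.inr))}

/-- The coheir chain condition. -/
def CoheirChain (R : IndRel L 𝕄) (κ : Cardinal.{u}) : Prop :=
  ∀ (Ms : Set 𝕄), IsElemSubmodel L Ms → Cardinal.mk Ms < κ →
    ∀ (α β : Type u), Cardinal.mk α < κ → Cardinal.mk β < κ →
      ∀ (a : α → 𝕄) (b : β → 𝕄), R.rel (Set.range a) Ms (Set.range b) →
        ∀ I : ℕ → β → 𝕄, CoheirMorley L Ms I → I 0 = b →
          ∃ I' : ℕ → β → 𝕄, EqTpOver L Ms (flatSeq I') (flatSeq I) ∧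
            R.rel (Set.range a) Ms (⋃ i, Set.range (I' i)) ∧
            ∀ i, EqTpOver L (Ms ∪ Set.range a) (I' i) b

/-- `R` implies `⫝ʰ` : `A ⫝_M B` implies `tp(B / M A)` is finitely
satisfiable in `M`. -/
def StrongerThanH (R : IndRel L 𝕄) : Prop :=
  ∀ (A Ms B : Set 𝕄), IsElemSubmodel L Ms → R.rel A Ms B →
    FinSatIn L Ms (fun x : B => (x : 𝕄)) (Ms ∪ A)

end IndRel

/-- The axioms satisfied by the relations among which `⫝^CK` is weakest. -/
def GoodRel (R : IndRel L 𝕄) (κ : Cardinal.{u}) : Prop :=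
  R.StrongerThanH ∧ R.Invariant ∧ R.Mono ∧ R.Existence κ ∧ R.RightExt κ ∧ R.CoheirChain κ

/-- `R` is `⫝^CK` : the weakest relation implying `⫝ʰ` and satisfying
invariance, monotonicity, existence, right extension and the coheir chain
condition. -/
def IsCK (R : IndRel L 𝕄) (κ : Cardinal.{u}) : Prop :=
  GoodRel R κ ∧ ∀ R' : IndRel L 𝕄, GoodRel R' κ →
    ∀ A Ms B : Set 𝕄, R'.rel A Ms B → R.rel A Ms B

/-- `q` is a canonical global type over `Ms` (w.r.t. the relation `R = ⫝^CK`):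
whenever `c ⊨ q|_{Ms b}` we have `b ⫝^CK_{Ms} c`. -/
def IsCanonicalGlobal (R : IndRel L 𝕄) (κ : Cardinal.{u}) (Ms : Set 𝕄) {α : Type v}
    (q : GlobalType L 𝕄 α) : Prop :=
  ∀ (β : Type u), Cardinal.mk β < κ → ∀ (b : β → 𝕄) (c : α → 𝕄),
    RealizesType q c (Ms ∪ Set.range b) → R.rel (Set.range b) Ms (Set.range c)

/-- A canonical Morley sequence over `Ms`: a coheir Morley sequence in a
canonical coheir. -/
def CanonicalMorley (R : IndRel L 𝕄) (κ : Cardinal.{u}) (Ms : Set 𝕄) {α : Type v}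
    (I : ℕ → α → 𝕄) : Prop :=
  ∃ q : GlobalType L 𝕄 α, IsCanonicalGlobal R κ Ms q ∧ MorleyIn q Ms I

/-- `q` is a strong canonical global type over `Ms`. -/
def IsStrongCanonical (R : IndRel L 𝕄) (κ : Cardinal.{u}) (Ms : Set 𝕄) {α : Type v}
    (q : GlobalType L 𝕄 α) : Prop :=
  ∀ (β : Type u), Cardinal.mk β < κ → ∀ (b : β → 𝕄) (c : α → 𝕄),
    RealizesType q c (Ms ∪ Set.range b) →
    ∀ (γ : Type u), Cardinal.mk γ < κ → ∀ (a : γ → 𝕄),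
      ∃ a' : γ → 𝕄, EqTpOver L (Ms ∪ Set.range c) a' a ∧
        ∃ q' : GlobalType L 𝕄 (γ ⊕ α), IsCanonicalGlobal R κ Ms q' ∧
          ExtendsTpOver q' (Ms ∪ Set.range b) (Sum.elim a' c)

/-! ### `M`-invariant ideals and `𝓘`-Kim-dividing -/

/-- An `Ms`-invariant ideal on the definable subsets of `𝕄` (in variables `α`). -/
structure InvIdeal (L : FirstOrder.Language.{u, u}) (𝕄 : Type u) [L.Structure 𝕄] (Ms : Set 𝕄)
    (α : Type v) where
  mem : Set (α → 𝕄) → Prop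
  definable_of_mem : ∀ S, mem S → ∃ (n : ℕ) (ψ : L.Formula (α ⊕ Fin n)) (c : Fin n → 𝕄),
    S = {a : α → 𝕄 | ψ.Realize (Sum.elim a c)}
  union_mem : ∀ S T, mem S → mem T → mem (S ∪ T)
  subset_mem : ∀ S T, mem S →
    (∃ (n : ℕ) (ψ : L.Formula (α ⊕ Fin n)) (c : Fin n → 𝕄),
      T = {a : α → 𝕄 | ψ.Realize (Sum.elim a c)}) →
    T ⊆ S → mem T
  invariant : ∀ σ : 𝕄 ≃[L] 𝕄, (∀ x ∈ Ms, σ x = x) → ∀ S, mem S →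
    mem ((fun a => (⇑σ) ∘ a) '' S)

/-- `φ(x, b)` `𝓘`-Kim-divides over `Ms`. -/
def IKimDivides {Ms : Set 𝕄} {α : Type v} (I : InvIdeal L 𝕄 Ms α) {n : ℕ}
    (φ : L.Formula (α ⊕ Fin n)) (b : Fin n → 𝕄) : Prop :=
  ∃ (B : ℕ → Fin n → 𝕄) (k : ℕ), CoheirMorley L Ms B ∧ B 0 = b ∧ 0 < k ∧
    ∀ s : Finset ℕ, s.card = k →
      I.mem {a : α → 𝕄 | ∀ i ∈ s, φ.Realize (Sum.elim a (B i))}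

/-- `φ(x, b)` `𝓘`-Kim-forks over `Ms`. -/
def IKimForks {Ms : Set 𝕄} {α : Type v} (I : InvIdeal L 𝕄 Ms α) {n : ℕ}
    (φ : L.Formula (α ⊕ Fin n)) (b : Fin n → 𝕄) : Prop :=
  ∃ (N : ℕ) (m : Fin N → ℕ) (ψ : ∀ j : Fin N, L.Formula (α ⊕ Fin (m j)))
    (c : ∀ j : Fin N, Fin (m j) → 𝕄),
    (∀ j, IKimDivides I (ψ j) (c j)) ∧
    ∀ a : α → 𝕄, φ.Realize (Sum.elim a b) → ∃ j, (ψ j).Realize (Sum.elim a (c j))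

/-- `φ(x, b)` `𝓘`-quasi-divides over `Ms`. -/
def IQuasiDivides {Ms : Set 𝕄} {α : Type v} (I : InvIdeal L 𝕄 Ms α) {n : ℕ}
    (φ : L.Formula (α ⊕ Fin n)) (b : Fin n → 𝕄) : Prop :=
  ∃ (mm : ℕ) (b' : Fin mm → Fin n → 𝕄), 0 < mm ∧ (∀ j, EqTpOver L Ms (b' j) b) ∧
    I.mem {a : α → 𝕄 | ∀ j, φ.Realize (Sum.elim a (b' j))}

/-! ### `h^⫝`-inconsistency and the derived relation `⫝'` -/

/-- A family of formulas is `h^⫝`-inconsistent with respect to `P = tp(a₀/Ms)`. -/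
def HInconsistent (R : IndRel L 𝕄) (Ms : Set 𝕄) {α : Type v} (a₀ : α → 𝕄)
    {ι : Type w} (m : ι → ℕ) (φ : ∀ i : ι, L.Formula (α ⊕ Fin (m i)))
    (b : ∀ i : ι, Fin (m i) → 𝕄) : Prop :=
  ¬ ∃ a : α → 𝕄, EqTpOver L Ms a a₀ ∧
      R.rel (Set.range a) Ms (⋃ i, Set.range (b i)) ∧
      ∀ i, (φ i).Realize (Sum.elim a (b i))

/-- A single formula is `h^⫝`-inconsistent with respect to `P = tp(a₀/Ms)`. -/
def HInconsistentSingle (R : IndRel L 𝕄) (Ms : Set 𝕄) {α : Type v} (a₀ : α → 𝕄)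
    {n : ℕ} (φ : L.Formula (α ⊕ Fin n)) (b : Fin n → 𝕄) : Prop :=
  ¬ ∃ a : α → 𝕄, EqTpOver L Ms a a₀ ∧ R.rel (Set.range a) Ms (Set.range b) ∧
      φ.Realize (Sum.elim a b)

/-- `φ(x, b)` `h^⫝`-Kim-divides with respect to `tp(a₀/Ms)`. -/
def HKimDivides (R : IndRel L 𝕄) (Ms : Set 𝕄) {α : Type v} (a₀ : α → 𝕄)
    {n : ℕ} (φ : L.Formula (α ⊕ Fin n)) (b : Fin n → 𝕄) : Prop :=
  ∃ B : ℕ → Fin n → 𝕄, CoheirMorley L Ms B ∧ B 0 = b ∧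
    HInconsistent R Ms a₀ (fun _ : ℕ => n) (fun _ => φ) B

/-- `φ(x, b)` `h^⫝`-Kim-forks with respect to `tp(a₀/Ms)`. -/
def HKimForks (R : IndRel L 𝕄) (Ms : Set 𝕄) {α : Type v} (a₀ : α → 𝕄)
    {n : ℕ} (φ : L.Formula (α ⊕ Fin n)) (b : Fin n → 𝕄) : Prop :=
  ∃ (N : ℕ) (m : Fin N → ℕ) (ψ : ∀ j : Fin N, L.Formula (α ⊕ Fin (m j)))
    (c : ∀ j : Fin N, Fin (m j) → 𝕄),
    (∀ j, HKimDivides R Ms a₀ (ψ j) (c j)) ∧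
    ∀ a : α → 𝕄, φ.Realize (Sum.elim a b) → ∃ j, (ψ j).Realize (Sum.elim a (c j))

/-- `φ(x, b)` `h^⫝`-quasi-divides with respect to `tp(a₀/Ms)`. -/
def HQuasiDivides (R : IndRel L 𝕄) (Ms : Set 𝕄) {α : Type v} (a₀ : α → 𝕄)
    {n : ℕ} (φ : L.Formula (α ⊕ Fin n)) (b : Fin n → 𝕄) : Prop :=
  ∃ (mm : ℕ) (b' : Fin mm → Fin n → 𝕄), 0 < mm ∧ (∀ j, EqTpOver L Ms (b' j) b) ∧
    HInconsistent R Ms a₀ (fun _ : Fin mm => n) (fun _ => φ) b'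

/-- The derived relation `⫝'` on tuples:
`tp(a / Ms b)` contains no formula `h^⫝`-Kim-forking w.r.t. `tp(a/Ms)`. -/
def DerivedIndep (R : IndRel L 𝕄) (Ms : Set 𝕄) {α : Type v} {β : Type w}
    (a : α → 𝕄) (b : β → 𝕄) : Prop :=
  ∀ (n : ℕ) (φ : L.Formula (α ⊕ Fin n)) (d : Fin n → 𝕄),
    (∀ i, d i ∈ Ms ∪ Set.range b) → φ.Realize (Sum.elim a d) →
    ¬ HKimForks R Ms a φ d

/-- The derived relation `⫝'` as a relation between sets over models. -/
def derived (R : IndRel L 𝕄) : IndRel L 𝕄 where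
  rel A Ms B := ∀ (n : ℕ) (φ : L.Formula (↥A ⊕ Fin n)) (d : Fin n → 𝕄),
    (∀ i, d i ∈ Ms ∪ B) → φ.Realize (Sum.elim (fun x : A => (x : 𝕄)) d) →
    ¬ HKimForks R Ms (fun x : A => (x : 𝕄)) φ d

/-! ### Coheir trees -/

/-- The tuple, indexed by extensions, consisting of the part of the tree `c`
lying (weakly) above the node `ν` (where `ν` has length `Lh`). -/
def subtreeTupleLen {α : Type v} {n : ℕ} (c : {l : List ℕ // l.length ≤ n} → α → 𝕄)
    (Lh : ℕ) (ν : List ℕ) (hν : ν.length = Lh) :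
    ({s : List ℕ // Lh + s.length ≤ n} × α) → 𝕄 :=
  fun p => c ⟨ν ++ p.1.1, by rw [List.length_append, hν]; exact p.1.2⟩ p.2

end NSOP2Paper

namespace NSOP2Paper

section Auxiliary

/-! ### Definable sets of tuples -/

open Set Filter

variable {L : FirstOrder.Language.{u, u}} {𝕄 : Type u} [L.Structure 𝕄]

/-- Sets of tuples definable over `C` are those given by a formula with a finite tuple of
parameters from `C`. -/
theorem definable_iff_exists_params {C : Set 𝕄} {α : Type v} {S : Set (α → 𝕄)} :
    C.Definable L S ↔ ∃ (n : ℕ) (φ : L.Formula (α ⊕ Fin n)) (c : Fin n → 𝕄),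
      (∀ i, c i ∈ C) ∧ ∀ a, a ∈ S ↔ φ.Realize (Sum.elim a c) := by
  constructor
  · intro h
    obtain ⟨A, hA, hS⟩ := definable_iff_finitely_definable.1 h
    obtain ⟨φ, rfl⟩ := definable_iff_exists_formula_sum.1 hS
    let e := A.equivFin
    refine ⟨A.card, φ.relabel (Sum.elim (fun x => Sum.inr (e x)) Sum.inl),
      fun i => (e.symm i : 𝕄), fun i => hA (e.symm i).2, fun a => ?_⟩
    rw [Formula.realize_relabel, mem_ofPred_eq]
    apply iff_of_eq
    congr 1
    ext (x | x) <;> simp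
  · rintro ⟨n, φ, c, hc, hS⟩
    refine definable_iff_exists_formula_sum.2
      ⟨φ.relabel (Sum.elim Sum.inr fun i => Sum.inl ⟨c i, hc i⟩), ?_⟩
    ext a
    rw [hS, mem_ofPred_eq, Formula.realize_relabel]
    apply iff_of_eq
    congr 1
    ext (x | x) <;> simp

theorem definable_setOf_realize {C : Set 𝕄} {α : Type v} {n : ℕ} (φ : L.Formula (α ⊕ Fin n))
    {c : Fin n → 𝕄} (hc : ∀ i, c i ∈ C) :
    C.Definable L {a : α → 𝕄 | φ.Realize (Sum.elim a c)} :=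
  definable_iff_exists_params.2 ⟨n, φ, c, hc, fun _ => Iff.rfl⟩

theorem eqTpOver_iff {C : Set 𝕄} {α : Type v} {a b : α → 𝕄} :
    EqTpOver L C a b ↔ ∀ S : Set (α → 𝕄), C.Definable L S → (a ∈ S ↔ b ∈ S) := by
  constructor
  · intro h S hS
    obtain ⟨n, φ, c, hc, hφ⟩ := definable_iff_exists_params.1 hS
    rw [hφ, hφ]
    exact h n φ c hc
  · intro h n φ c hc
    exact h _ (definable_setOf_realize φ hc)

/-- Preimages of definable sets under maps whose coordinates are coordinate projections or
constants. -/
theorem definable_preimage {C : Set 𝕄} {α : Type v} {β : Type w} {S : Set (α → 𝕄)}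
    (hS : C.Definable L S) (F : (β → 𝕄) → α → 𝕄)
    (hF : ∀ i, (∃ j, ∀ g, F g i = g j) ∨ ∃ x ∈ C, ∀ g, F g i = x) :
    C.Definable L (F ⁻¹' S) := by
  have hF' : ∀ i, ∃ k : C ⊕ β, ∀ g, F g i = Sum.elim (↑) g k := by
    intro i
    obtain ⟨j, hj⟩ | ⟨x, hx, h⟩ := hF i
    · exact ⟨Sum.inr j, hj⟩
    · exact ⟨Sum.inl ⟨x, hx⟩, h⟩
  choose k hk using hF'
  obtain ⟨φ, rfl⟩ := definable_iff_exists_formula_sum.1 hS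
  refine definable_iff_exists_formula_sum.2 ⟨φ.relabel (Sum.elim Sum.inl k), ?_⟩
  ext g
  rw [mem_preimage, mem_ofPred_eq, mem_ofPred_eq, Formula.realize_relabel]
  apply iff_of_eq
  congr 1
  ext (x | x) <;> simp [hk]

theorem definable_preimage_equiv (σ : 𝕄 ≃[L] 𝕄) {C D : Set 𝕄} (hD : D ⊆ σ '' C) {α : Type v}
    {S : Set (α → 𝕄)} (hS : D.Definable L S) :
    C.Definable L {g : α → 𝕄 | (⇑σ) ∘ g ∈ S} := by
  obtain ⟨φ, rfl⟩ := definable_iff_exists_formula_sum.1 hS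
  choose k hk hk' using hD
  refine definable_iff_exists_formula_sum.2
    ⟨φ.relabel (Sum.map (fun y : D => (⟨k y.2, hk y.2⟩ : C)) id), ?_⟩
  ext g
  rw [mem_ofPred_eq, mem_ofPred_eq, mem_ofPred_eq, Formula.realize_relabel]
  refine Iff.trans (iff_of_eq ?_) (StrongHomClass.realize_formula σ φ)
  congr 1
  ext (x | x) <;> simp [hk']

theorem definable_fiber {C : Set 𝕄} {α : Type v} {β : Type w} (a : α → 𝕄) {S : Set (β → 𝕄)}
    (hS : (C ∪ range a).Definable L S) :
    ∃ T : Set (α ⊕ β → 𝕄), C.Definable L T ∧ ∀ x, x ∈ S ↔ Sum.elim a x ∈ T := by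
  obtain ⟨φ, rfl⟩ := definable_iff_exists_formula_sum.1 hS
  have h : ∀ y : ↥(C ∪ range a), ∃ k : C ⊕ α, (y : 𝕄) = Sum.elim (↑) a k := by
    rintro ⟨y, hy | ⟨i, rfl⟩⟩
    · exact ⟨Sum.inl ⟨y, hy⟩, rfl⟩
    · exact ⟨Sum.inr i, rfl⟩
  choose k hk using h
  refine ⟨{g | (φ.relabel (Sum.elim (fun y => Sum.map id Sum.inl (k y))
      (fun i => Sum.inr (Sum.inr i))) : L.Formula (C ⊕ (α ⊕ β))).Realize (Sum.elim (↑) g)},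
    definable_iff_exists_formula_sum.2 ⟨_, rfl⟩, fun x => ?_⟩
  rw [mem_ofPred_eq, mem_ofPred_eq, Formula.realize_relabel]
  apply iff_of_eq
  congr 1
  ext (y | y)
  · simp only [Sum.elim_inl, Function.comp_apply, hk]
    cases k y <;> rfl
  · rfl

/-! ### Equality of types -/

namespace EqTpOver

variable {C D : Set 𝕄} {α : Type v} {β : Type w} {a b c : α → 𝕄}

theorem symm (h : EqTpOver L C a b) : EqTpOver L C b a :=
  fun n φ p hp => (h n φ p hp).symm

theorem trans (h : EqTpOver L C a b) (h' : EqTpOver L C b c) : EqTpOver L C a c :=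
  fun n φ p hp => (h n φ p hp).trans (h' n φ p hp)

theorem mono (h : EqTpOver L D a b) (hCD : C ⊆ D) : EqTpOver L C a b :=
  fun n φ p hp => h n φ p fun i => hCD (hp i)

theorem comp (h : EqTpOver L C a b) (f : β → α) : EqTpOver L C (a ∘ f) (b ∘ f) := by
  rw [eqTpOver_iff] at h ⊢
  exact fun S hS => h _ (hS.preimage_comp f)

theorem eq_of_mem (h : EqTpOver L C a b) {i : α} (hi : b i ∈ C) : a i = b i := by
  have := h 1 ((Term.var (Sum.inl i)).equal (Term.var (Sum.inr 0))) (fun _ => b i) fun _ => hi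
  simpa [Formula.realize_equal] using this

/-- A tuple may be moved into the base. -/
theorem of_sumElim {a : β → 𝕄} {x y : α → 𝕄}
    (h : EqTpOver L C (Sum.elim a x) (Sum.elim a y)) : EqTpOver L (C ∪ range a) x y := by
  rw [eqTpOver_iff] at h ⊢
  intro S hS
  obtain ⟨T, hT, hST⟩ := definable_fiber a hS
  rw [hST, hST]
  exact h T hT

/-- A tuple from the base may be adjoined to the tuples. -/
theorem sumElim {a : β → 𝕄} {x y : α → 𝕄} (ha : range a ⊆ C)
    (h : EqTpOver L C x y) : EqTpOver L C (Sum.elim a x) (Sum.elim a y) := by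
  rw [eqTpOver_iff] at h ⊢
  intro S hS
  refine h _ (definable_preimage hS (fun x => Sum.elim a x) ?_)
  rintro (i | i)
  · exact Or.inr ⟨a i, ha ⟨i, rfl⟩, fun _ => rfl⟩
  · exact Or.inl ⟨i, fun _ => rfl⟩

theorem sumElim_comm {a a' : β → 𝕄} {x y : α → 𝕄}
    (h : EqTpOver L C (Sum.elim a x) (Sum.elim a' y)) :
    EqTpOver L C (Sum.elim x a) (Sum.elim y a') := by
  have := h.comp (Sum.swap : α ⊕ β → β ⊕ α)
  rwa [show Sum.elim a x ∘ Sum.swap = Sum.elim x a by ext (i | i) <;> rfl,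
    show Sum.elim a' y ∘ Sum.swap = Sum.elim y a' by ext (i | i) <;> rfl] at this

theorem map_equiv (h : EqTpOver L C a b) (σ : 𝕄 ≃[L] 𝕄) :
    EqTpOver L (σ '' C) ((⇑σ) ∘ a) ((⇑σ) ∘ b) := by
  rw [eqTpOver_iff] at h ⊢
  exact fun S hS => h _ (definable_preimage_equiv σ subset_rfl hS)

end EqTpOver

theorem image_eq_of_fixes {σ : 𝕄 ≃[L] 𝕄} {C : Set 𝕄} (hσ : ∀ x ∈ C, σ x = x) : σ '' C = C := by
  rw [image_congr hσ, image_id']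

/-- An automorphism fixing `C` pointwise preserves every set definable over `C`. -/
theorem mem_iff_of_fixes {σ : 𝕄 ≃[L] 𝕄} {C : Set 𝕄} (hσ : ∀ x ∈ C, σ x = x) {α : Type v}
    {S : Set (α → 𝕄)} (hS : C.Definable L S) (a : α → 𝕄) : (⇑σ) ∘ a ∈ S ↔ a ∈ S := by
  obtain ⟨φ, rfl⟩ := definable_iff_exists_formula_sum.1 hS
  rw [mem_ofPred_eq, mem_ofPred_eq]
  refine Iff.trans (iff_of_eq ?_) (StrongHomClass.realize_formula σ φ)
  congr 1
  ext (x | x) <;> simp [hσ]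

theorem eqTpOver_of_fixes {σ : 𝕄 ≃[L] 𝕄} {C : Set 𝕄} (hσ : ∀ x ∈ C, σ x = x) {α : Type v}
    (a : α → 𝕄) : EqTpOver L C ((⇑σ) ∘ a) a :=
  eqTpOver_iff.2 fun _ hS => mem_iff_of_fixes hσ hS a

/-! ### Homogeneity and saturation -/

namespace IsMonster

variable {κ : Cardinal.{u}}

theorem aleph0_le (h : IsMonster L 𝕄 κ) : Cardinal.aleph0 ≤ κ := h.1.le

theorem mk_sum_lt (h : IsMonster L 𝕄 κ) {α β : Type u} (hα : Cardinal.mk α < κ)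
    (hβ : Cardinal.mk β < κ) : Cardinal.mk (α ⊕ β) < κ := by
  simpa using Cardinal.add_lt_of_lt h.aleph0_le hα hβ

theorem mk_union_lt (h : IsMonster L 𝕄 κ) {A B : Set 𝕄} (hA : Cardinal.mk A < κ)
    (hB : Cardinal.mk B < κ) : Cardinal.mk ↥(A ∪ B) < κ :=
  (Cardinal.mk_union_le A B).trans_lt (Cardinal.add_lt_of_lt h.aleph0_le hA hB)

theorem mk_union_range_lt (h : IsMonster L 𝕄 κ) {A : Set 𝕄} {β : Type u} (hA : Cardinal.mk A < κ)
    (hβ : Cardinal.mk β < κ) (b : β → 𝕄) : Cardinal.mk ↥(A ∪ range b) < κ :=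
  h.mk_union_lt hA (Cardinal.mk_range_le.trans_lt hβ)

/-- Tuples with the same type over a small set are conjugate over that set. -/
theorem exists_equiv (h : IsMonster L 𝕄 κ) {C : Set 𝕄} (hC : Cardinal.mk C < κ) {α : Type u}
    (hα : Cardinal.mk α < κ) {a b : α → 𝕄} (hab : EqTpOver L C a b) :
    ∃ σ : 𝕄 ≃[L] 𝕄, (∀ x ∈ C, σ x = x) ∧ (⇑σ) ∘ a = b := by
  obtain ⟨σ, hσ⟩ := h.2.2 (C ⊕ α) (h.mk_sum_lt hC hα) (Sum.elim (↑) a) (Sum.elim (↑) b)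
    ((hab.sumElim (a := ((↑) : C → 𝕄)) (by simp)).mono (empty_subset C))
  exact ⟨σ, fun x hx => hσ (Sum.inl ⟨x, hx⟩), funext fun i => hσ (Sum.inr i)⟩

end IsMonster

/-- The tuple `a` realizes over `C` the average type of the ultrafilter `U`. -/
def Satisfies (L : FirstOrder.Language.{u, u}) {𝕄 : Type u} [L.Structure 𝕄] {α : Type v}
    (U : Ultrafilter (α → 𝕄)) (C : Set 𝕄) (a : α → 𝕄) : Prop :=
  ∀ S : Set (α → 𝕄), C.Definable L S → (a ∈ S ↔ S ∈ U)


namespace Satisfies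

variable {α : Type v} {β : Type w} {U : Ultrafilter (α → 𝕄)} {C D : Set 𝕄} {a b : α → 𝕄}

/-- It suffices to check that the definable sets in the ultrafilter contain the tuple. -/
theorem of_forall_mem (h : ∀ S : Set (α → 𝕄), C.Definable L S → S ∈ U → a ∈ S) :
    Satisfies L U C a := by
  refine fun S hS => ⟨fun haS => ?_, h S hS⟩
  by_contra hn
  exact h _ hS.compl (Ultrafilter.compl_mem_iff_notMem.2 hn) haS

theorem mono (h : Satisfies L U D a) (hCD : C ⊆ D) : Satisfies L U C a :=
  fun S hS => h S (hS.mono hCD)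

theorem comp (h : Satisfies L U C a) (f : β → α) :
    Satisfies L (U.map fun g => g ∘ f) C (a ∘ f) :=
  fun _ hS => h _ (hS.preimage_comp f)

protected theorem eqTpOver (ha : Satisfies L U C a) (hb : Satisfies L U C b) : EqTpOver L C a b :=
  eqTpOver_iff.2 fun S hS => (ha S hS).trans (hb S hS).symm

theorem of_eqTpOver (ha : Satisfies L U C a) (h : EqTpOver L C b a) : Satisfies L U C b :=
  fun S hS => (eqTpOver_iff.1 h S hS).trans (ha S hS)

theorem eqTpOver_of_eventually (ha : Satisfies L U C a) (h : ∀ᶠ g in U, EqTpOver L C g b) :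
    EqTpOver L C a b := by
  rw [eqTpOver_iff]
  refine fun S hS => (ha S hS).trans ⟨?_, ?_⟩
  · intro hU
    obtain ⟨g, hg, hgb⟩ := ((show ∀ᶠ g in U, g ∈ S from hU).and h).exists
    exact (eqTpOver_iff.1 hgb S hS).1 hg
  · intro hb
    filter_upwards [h] with g hg using (eqTpOver_iff.1 hg S hS).2 hb

end Satisfies

theorem IsMonster.exists_satisfies {κ : Cardinal.{u}} (h : IsMonster L 𝕄 κ) {C : Set 𝕄}
    (hC : Cardinal.mk C < κ) {α : Type u} (hα : Cardinal.mk α < κ) (U : Ultrafilter (α → 𝕄)) :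
    ∃ a, Satisfies L U C a := by
  obtain ⟨a, ha⟩ := h.2.1 α C hα hC
    {p | (∀ i, p.2.2 i ∈ C) ∧ {a | p.2.1.Realize (Sum.elim a p.2.2)} ∈ U} (fun p hp => hp.1)
    (fun t ht => by
      have hmem : ∀ᶠ a : α → 𝕄 in U, ∀ p ∈ t, p.2.1.Realize (Sum.elim a p.2.2) :=
        (eventually_all_finset t).2 fun p hp => (ht hp).2
      exact hmem.exists)
  refine ⟨a, Satisfies.of_forall_mem fun S hS hU => ?_⟩
  obtain ⟨n, φ, c, hc, hφ⟩ := definable_iff_exists_params.1 hS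
  rw [hφ]
  refine ha ⟨n, φ, c⟩ ⟨hc, ?_⟩
  rwa [show S = {a | φ.Realize (Sum.elim a c)} from Set.ext hφ] at hU

/-! ### Global types and ultrafilters -/

/-- The average type of an ultrafilter on tuples. -/
def GlobalType.ofUltrafilter {α : Type v} (U : Ultrafilter (α → 𝕄)) : GlobalType L 𝕄 α where
  carrier := {p | {a | p.2.1.Realize (Sum.elim a p.2.2)} ∈ U}
  consistent t ht := by
    have hmem : ∀ᶠ a : α → 𝕄 in U, ∀ p ∈ t, p.2.1.Realize (Sum.elim a p.2.2) :=
      (eventually_all_finset t).2 fun p hp => ht hp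
    exact hmem.exists
  complete n φ c := U.em fun a => φ.Realize (Sum.elim a c)

theorem realizesType_ofUltrafilter {α : Type v} {U : Ultrafilter (α → 𝕄)} {C : Set 𝕄}
    {a : α → 𝕄} :
    RealizesType (GlobalType.ofUltrafilter (L := L) U) a C ↔ Satisfies L U C a := by
  constructor
  · intro h
    refine Satisfies.of_forall_mem fun S hS hU => ?_
    obtain ⟨n, φ, c, hc, hφ⟩ := definable_iff_exists_params.1 hS
    rw [hφ]
    refine h n φ c hc ?_
    rwa [show S = {a | φ.Realize (Sum.elim a c)} from Set.ext hφ] at hU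
  · intro h n φ c hc hmem
    exact (h _ (definable_setOf_realize φ hc)).2 hmem

theorem extendsTpOver_ofUltrafilter {α : Type v} {U : Ultrafilter (α → 𝕄)} {C : Set 𝕄}
    {a : α → 𝕄} (h : Satisfies L U C a) :
    ExtendsTpOver (GlobalType.ofUltrafilter (L := L) U) C a :=
  fun _ φ _ hc hr => (h _ (definable_setOf_realize φ hc)).1 hr

/-- A global type finitely satisfiable in `Ms` is the average type of an ultrafilter
concentrating on tuples from `Ms`. -/
theorem GlobalType.FinSatInM.exists_ultrafilter {α : Type v} {q : GlobalType L 𝕄 α}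
    {Ms : Set 𝕄} (h : q.FinSatInM Ms) :
    ∃ U : Ultrafilter (α → 𝕄), (∀ᶠ g : α → 𝕄 in U, ∀ i, g i ∈ Ms) ∧
      ∀ p ∈ q.carrier, ∀ᶠ g in U, p.2.1.Realize (Sum.elim g p.2.2) := by
  classical
  choose m hm hm' using fun t : Finset q.carrier => h (t.map (Function.Embedding.subtype _))
    (by simp)
  refine ⟨(Ultrafilter.of atTop).map m, ?_, fun p hp => ?_⟩
  · rw [Ultrafilter.coe_map, eventually_map]
    exact Eventually.of_forall hm
  · rw [Ultrafilter.coe_map, eventually_map]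
    filter_upwards [Ultrafilter.of_le _ (eventually_ge_atTop {⟨p, hp⟩})] with t ht
    exact hm' t p (by simpa [hp] using ht)
/-- Every coheir Morley sequence is one in the average type of an ultrafilter concentrating on
tuples from `Ms`. -/
theorem CoheirMorley.exists_ultrafilter {α : Type v} {Ms : Set 𝕄} {B : ℕ → α → 𝕄}
    (h : CoheirMorley L Ms B) :
    ∃ U : Ultrafilter (α → 𝕄), (∀ᶠ g : α → 𝕄 in U, ∀ i, g i ∈ Ms) ∧
      ∀ i, Satisfies L U (Ms ∪ ⋃ (j : ℕ) (_ : j < i), range (B j)) (B i) := by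
  obtain ⟨q, hq, hB⟩ := h
  obtain ⟨U, hU, hqU⟩ := hq.exists_ultrafilter
  refine ⟨U, hU, fun i => Satisfies.of_forall_mem fun S hS hSU => ?_⟩
  obtain ⟨n, φ, c, hc, hφ⟩ := definable_iff_exists_params.1 hS
  rw [hφ]
  refine hB i n φ c hc ((q.complete n φ c).resolve_right fun hn => ?_)
  obtain ⟨g, hg, hg'⟩ := ((hqU _ hn).and (show ∀ᶠ g in U, g ∈ S from hSU)).exists
  exact (Formula.realize_not.1 hg) ((hφ g).1 hg')

theorem coheirMorley_of_ultrafilter {α : Type v} {Ms : Set 𝕄} {B : ℕ → α → 𝕄}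
    (U : Ultrafilter (α → 𝕄)) (hU : ∀ᶠ g : α → 𝕄 in U, ∀ i, g i ∈ Ms)
    (hB : ∀ i, Satisfies L U (Ms ∪ ⋃ (j : ℕ) (_ : j < i), range (B j)) (B i)) :
    CoheirMorley L Ms B := by
  refine ⟨GlobalType.ofUltrafilter U, fun t ht => ?_, fun i =>
    realizesType_ofUltrafilter.2 (hB i)⟩
  have hmem : ∀ᶠ g : α → 𝕄 in U, ∀ p ∈ t, p.2.1.Realize (Sum.elim g p.2.2) :=
    (eventually_all_finset t).2 fun p hp => ht hp
  exact (hU.and hmem).exists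

/-- An enumeration of `Ms` may be adjoined to every term of a coheir Morley sequence. -/
theorem CoheirMorley.sumElim_base {α : Type u} {Ms : Set 𝕄} {B : ℕ → α → 𝕄}
    (h : CoheirMorley L Ms B) :
    CoheirMorley L Ms fun i => Sum.elim ((↑) : Ms → 𝕄) (B i) := by
  obtain ⟨U, hU, hB⟩ := h.exists_ultrafilter
  refine coheirMorley_of_ultrafilter (U.map fun g => Sum.elim (↑) g) ?_ fun i => ?_
  · rw [Ultrafilter.coe_map, eventually_map]
    filter_upwards [hU] with g hg
    rintro (x | x)
    · exact x.2
    · exact hg x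
  · have hsub : (Ms ∪ ⋃ (j : ℕ) (_ : j < i), range (Sum.elim ((↑) : Ms → 𝕄) (B j))) ⊆
        Ms ∪ ⋃ (j : ℕ) (_ : j < i), range (B j) := by
      refine union_subset subset_union_left (iUnion₂_subset fun j hj => ?_)
      rw [Sum.elim_range, Subtype.range_coe]
      exact union_subset_union_right _ (subset_iUnion₂ (s := fun j (_ : j < i) => range (B j)) j hj)
    intro S hS
    refine hB i _ (definable_preimage (hS.mono hsub) (fun g => Sum.elim (↑) g) ?_)
    rintro (x | x)
    · exact Or.inr ⟨x, Or.inl x.2, fun _ => rfl⟩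
    · exact Or.inl ⟨x, fun _ => rfl⟩

/-! ### Closing an independence relation on the left -/

/-- `tp(a / Ms B)` is a limit of types over `Ms B` of tuples `g ≡_Ms a` with
`Ms g ⫝_Ms Ms B`. -/
def LeftClosure (R : IndRel L 𝕄) (Ms : Set 𝕄) {α : Type v} (a : α → 𝕄) (B : Set 𝕄) : Prop :=
  ∃ U : Ultrafilter (α → 𝕄), Satisfies L U (Ms ∪ B) a ∧
    ∀ᶠ g in U, EqTpOver L Ms g a ∧ R.rel (Ms ∪ range g) Ms (Ms ∪ B)

namespace LeftClosure

variable {R : IndRel L 𝕄} {Ms B : Set 𝕄} {α : Type v} {a : α → 𝕄}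

theorem of_rel (h : R.rel (Ms ∪ range a) Ms (Ms ∪ B)) : LeftClosure R Ms a B :=
  ⟨pure a, fun _ _ => Ultrafilter.mem_pure.symm, by
    rw [Ultrafilter.coe_pure, eventually_pure]
    exact ⟨fun _ _ _ _ => Iff.rfl, h⟩⟩

theorem comp_surjective (h : LeftClosure R Ms a B) {β : Type w} {f : β → α}
    (hf : Function.Surjective f) : LeftClosure R Ms (a ∘ f) B := by
  obtain ⟨U, hU, hR⟩ := h
  refine ⟨U.map fun g => g ∘ f, hU.comp f, ?_⟩
  rw [Ultrafilter.coe_map, eventually_map]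
  filter_upwards [hR] with g hg
  rw [hf.range_comp]
  exact ⟨hg.1.comp f, hg.2⟩

theorem mono (h : LeftClosure R Ms a B) (hR : R.Mono) (hMs : IsElemSubmodel L Ms)
    {β : Type w} {a' : β → 𝕄} (ha : range a' ⊆ range a) {B' : Set 𝕄} (hB : B' ⊆ B) :
    LeftClosure R Ms a' B' := by
  obtain ⟨U, hU, hUR⟩ := h
  choose f hf using fun i => ha ⟨i, rfl⟩
  obtain rfl : a ∘ f = a' := funext hf
  refine ⟨U.map fun g => g ∘ f, (hU.comp f).mono (union_subset_union_right _ hB), ?_⟩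
  rw [Ultrafilter.coe_map, eventually_map]
  filter_upwards [hUR] with g hg
  exact ⟨hg.1.comp f, hR _ _ _ _ _ hMs hg.2 subset_union_left
    (union_subset_union_right _ (range_comp_subset_range f g)) subset_union_left
    (union_subset_union_right _ hB)⟩

theorem map_equiv (h : LeftClosure R Ms a B) (hR : R.Invariant) (σ : 𝕄 ≃[L] 𝕄) :
    LeftClosure R (σ '' Ms) ((⇑σ) ∘ a) (σ '' B) := by
  obtain ⟨U, hU, hUR⟩ := h
  refine ⟨U.map fun g => (⇑σ) ∘ g, fun S hS => ?_, ?_⟩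
  · rw [← image_union] at hS
    exact hU _ (definable_preimage_equiv σ subset_rfl hS)
  · rw [Ultrafilter.coe_map, eventually_map]
    filter_upwards [hUR] with g hg
    rw [range_comp, ← image_union, ← image_union]
    exact ⟨hg.1.map_equiv σ, hR σ _ _ _ hg.2⟩

end LeftClosure

/-- The relation obtained from `R` by adjoining the base to both sides and closing on the left. -/
def IndRel.leftClosure (R : IndRel L 𝕄) : IndRel L 𝕄 where
  rel A Ms B := LeftClosure R Ms ((↑) : A → 𝕄) B

namespace IndRel

variable {R : IndRel L 𝕄} {κ : Cardinal.{u}}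

theorem leftClosure_range_iff (hR : R.Mono) {Ms : Set 𝕄} (hMs : IsElemSubmodel L Ms)
    {α : Type v} {a : α → 𝕄} {B : Set 𝕄} :
    R.leftClosure.rel (range a) Ms B ↔ LeftClosure R Ms a B :=
  ⟨fun h => LeftClosure.mono h hR hMs (by rw [Subtype.range_coe]) subset_rfl,
    fun h => h.mono hR hMs (by rw [Subtype.range_coe]) subset_rfl⟩

theorem leftClosure_invariant (hR : R.Invariant) : R.leftClosure.Invariant := by
  intro σ A Ms B h
  have h' := (LeftClosure.map_equiv h hR σ).comp_surjective
    (f := (σ.toEquiv.image A).symm) (Equiv.surjective _)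
  have : ((⇑σ) ∘ ((↑) : A → 𝕄)) ∘ (σ.toEquiv.image A).symm = ((↑) : ↥(σ '' A) → 𝕄) := by
    ext x
    exact congrArg Subtype.val ((σ.toEquiv.image A).apply_symm_apply x)
  rwa [this] at h'

theorem leftClosure_mono (hR : R.Mono) : R.leftClosure.Mono :=
  fun _ _ _ _ _ hMs h _ hA _ hB => LeftClosure.mono h hR hMs (by simpa using hA) hB

theorem leftClosure_existence (hR : R.Existence κ) : R.leftClosure.Existence κ := by
  intro Ms hMs hMsκ α β hα hβ a b
  obtain ⟨a', ha', h⟩ := hR Ms hMs hMsκ α β hα hβ a b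
  exact ⟨a', ha', LeftClosure.of_rel (by
    rwa [Subtype.range_coe, ← union_assoc, ← union_assoc, union_self])⟩

theorem leftClosure_strongerThanH (hR : R.StrongerThanH) : R.leftClosure.StrongerThanH := by
  intro A Ms B hMs h n φ c hc hφ
  obtain ⟨U, hU, hUR⟩ := h
  have hc' : ∀ i, ∃ k : Ms ⊕ A, c i = Sum.elim (↑) (↑) k := by
    intro i
    obtain hi | hi := hc i
    · exact ⟨Sum.inl ⟨_, hi⟩, rfl⟩
    · exact ⟨Sum.inr ⟨_, hi⟩, rfl⟩
  choose k hk using hc'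
  let F : (B → 𝕄) → (A → 𝕄) → (B ⊕ Fin n → 𝕄) := fun x g =>
    Sum.elim x fun i => Sum.elim ((↑) : Ms → 𝕄) g (k i)
  have hdef : ∀ {D : Set 𝕄} {x : B → 𝕄}, (∀ i, x i ∈ D) → Ms ⊆ D →
      D.Definable L {g : A → 𝕄 | φ.Realize (F x g)} := by
    intro D x hx hD
    refine definable_preimage (definable_iff_exists_formula_sum.2
      ⟨φ.relabel Sum.inr, ?_⟩ : D.Definable L {y | φ.Realize y}) (F x) ?_
    · ext y
      rw [mem_ofPred_eq, mem_ofPred_eq, Formula.realize_relabel]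
      rfl
    · rintro (i | i)
      · exact Or.inr ⟨x i, hx i, fun _ => rfl⟩
      · cases hki : k i with
        | inl m => exact Or.inr ⟨m, hD m.2, fun g => by simp [F, hki]⟩
        | inr j => exact Or.inl ⟨j, fun g => by simp [F, hki]⟩
  have hFc : ∀ x, F x (↑) = Sum.elim x c := by
    intro x
    simp only [F]
    rw [← funext hk]
  have hmem : ∀ᶠ g : A → 𝕄 in U, φ.Realize (F (↑) g) :=
    (hU _ (hdef (fun i => Or.inr i.2) subset_union_left)).1 (by
      rw [mem_ofPred_eq, hFc]; exact hφ)
  obtain ⟨g, hg, hga, hgR⟩ := (hmem.and hUR).exists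
  obtain ⟨m, hm, hmφ⟩ := hR _ _ _ hMs hgR n
    (φ.relabel (Sum.map (inclusion subset_union_right) id))
    (fun i => Sum.elim ((↑) : Ms → 𝕄) g (k i))
    (fun i => by
      cases k i with
      | inl m => exact Or.inl m.2
      | inr j => exact Or.inr (Or.inr ⟨j, rfl⟩))
    (by
      rw [Formula.realize_relabel]
      convert hg using 1
      ext (i | i) <;> rfl)
  refine ⟨m ∘ inclusion subset_union_right, fun i => hm _, ?_⟩
  have hm' : φ.Realize (F (m ∘ inclusion subset_union_right) g) := by
    rw [Formula.realize_relabel] at hmφ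
    convert hmφ using 1
    ext (i | i) <;> rfl
  have := (eqTpOver_iff.1 hga _ (hdef (fun i => hm _) subset_rfl)).1 hm'
  rwa [mem_ofPred_eq, hFc] at this

theorem leftClosure_rightExt (hM : IsMonster L 𝕄 κ) (hR : R.Mono) (hRext : R.RightExt κ) :
    R.leftClosure.RightExt κ := by
  intro Ms hMs hMsκ α hα a B C hB hC h hBC
  obtain ⟨U, hU, hUR⟩ := (leftClosure_range_iff hR hMs).1 h
  have hex : ∀ᶠ g in U, ∃ g' : α → 𝕄, EqTpOver L (Ms ∪ B) g' g ∧ EqTpOver L Ms g a ∧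
      R.rel (Ms ∪ range g') Ms (Ms ∪ C) := by
    filter_upwards [hUR] with g ⟨hga, hg⟩
    rw [← Subtype.range_coe (s := Ms), ← Sum.elim_range, Subtype.range_coe] at hg
    obtain ⟨h, hh, hhR⟩ := hRext Ms hMs hMsκ (Ms ⊕ α) (hM.mk_sum_lt hMsκ hα)
      (Sum.elim (↑) g) _ _ (hM.mk_union_lt hMsκ hB) (hM.mk_union_lt hMsκ hC) hg
      (union_subset_union_right Ms hBC)
    have hl : h ∘ Sum.inl = ((↑) : Ms → 𝕄) :=
      funext fun i => hh.eq_of_mem (i := Sum.inl i) (Or.inl i.2)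
    refine ⟨h ∘ Sum.inr, hh.comp Sum.inr, hga, ?_⟩
    rwa [← Sum.elim_comp_inl_inr h, hl, Sum.elim_range, Subtype.range_coe] at hhR
  obtain ⟨f, hf⟩ := hex.choice
  obtain ⟨a', ha'⟩ := hM.exists_satisfies (hM.mk_union_lt hMsκ hC) hα (U.map f)
  have haa : EqTpOver L (Ms ∪ B) a' a := by
    refine eqTpOver_iff.2 fun S hS => ?_
    rw [ha' S (hS.mono (union_subset_union_right Ms hBC)), hU S hS, Ultrafilter.mem_map]
    refine eventually_congr ?_
    filter_upwards [hf] with g hg using eqTpOver_iff.1 hg.1 S hS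
  refine ⟨a', haa.mono subset_union_right,
    (leftClosure_range_iff hR hMs).2 ⟨U.map f, ha', ?_⟩⟩
  rw [Ultrafilter.coe_map, eventually_map]
  filter_upwards [hf] with g hg
  exact ⟨((hg.1.mono subset_union_left).trans hg.2.1).trans
    (haa.mono subset_union_left).symm, hg.2.2⟩

theorem leftClosure_coheirChain (hM : IsMonster L 𝕄 κ) (hR : R.Mono) (hRinv : R.Invariant)
    (hRchain : R.CoheirChain κ) : R.leftClosure.CoheirChain κ := by
  intro Ms hMs hMsκ α β hα hβ a b h I hI hIb
  obtain ⟨U, hU, hUR⟩ := (leftClosure_range_iff hR hMs).1 h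
  have hℕβ : Cardinal.mk (ℕ × β) < κ := by
    rw [Cardinal.mk_prod, Cardinal.lift_uzero, Cardinal.mk_nat, Cardinal.lift_aleph0]
    exact Cardinal.mul_lt_of_lt hM.aleph0_le hM.1 hβ
  have hrange : ∀ J : ℕ → β → 𝕄, ⋃ i, range (J i) = range (flatSeq J) := by
    intro J
    ext x
    simp [flatSeq]
  have hex : ∀ᶠ g in U, ∃ g' : α → 𝕄, EqTpOver L Ms g a ∧ EqTpOver L Ms g' g ∧
      (∀ i, EqTpOver L Ms (Sum.elim g' (I i)) (Sum.elim g b)) ∧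
      R.rel (Ms ∪ range g') Ms (Ms ∪ range (flatSeq I)) := by
    filter_upwards [hUR] with g ⟨hga, hg⟩
    have hval : ∀ {γ : Type u} (x : γ → 𝕄), range (Sum.elim ((↑) : Ms → 𝕄) x) = Ms ∪ range x := by
      intro γ x
      rw [Sum.elim_range, Subtype.range_coe]
    rw [← hval, ← hval] at hg
    obtain ⟨J, hJI, hJR, hJb⟩ := hRchain Ms hMs hMsκ _ _ (hM.mk_sum_lt hMsκ hα)
      (hM.mk_sum_lt hMsκ hβ) _ _ hg _ hI.sumElim_base (by rw [hIb])
    have hJI' : EqTpOver L Ms (flatSeq fun i => J i ∘ Sum.inr) (flatSeq I) :=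
      hJI.comp fun k : ℕ × β => (k.1, (Sum.inr k.2 : Ms ⊕ β))
    obtain ⟨σ, hσ, hσJ⟩ := hM.exists_equiv hMsκ hℕβ hJI'
    have hσI : ∀ i, (⇑σ) ∘ (J i ∘ Sum.inr) = I i := fun i =>
      funext fun j => congrFun hσJ (i, j)
    refine ⟨(⇑σ) ∘ g, hga, eqTpOver_of_fixes hσ g, fun i => ?_, ?_⟩
    · have h1 : EqTpOver L (Ms ∪ range g) (J i ∘ Sum.inr) b := by
        have := (hJb i).comp Sum.inr
        rw [hval, ← union_assoc, union_self] at this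
        exact this
      rw [← hσI i, ← Sum.comp_elim]
      exact (eqTpOver_of_fixes hσ _).trans
        ((h1.sumElim subset_union_right).mono subset_union_left)
    · have h2 := hRinv σ _ _ _ hJR
      have h3 : Ms ∪ range (flatSeq I) ⊆ σ '' ⋃ i, range (J i) := by
        rintro x (hx | ⟨⟨i, j⟩, rfl⟩)
        · refine ⟨x, mem_iUnion.2 ⟨0, Sum.inl ⟨x, hx⟩, ?_⟩, hσ x hx⟩
          exact (hJb 0).eq_of_mem (i := Sum.inl ⟨x, hx⟩) (Or.inl hx)
        · exact ⟨J i (Sum.inr j), mem_iUnion.2 ⟨i, Sum.inr j, rfl⟩, congrFun (hσI i) j⟩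
      rw [image_eq_of_fixes hσ] at h2
      refine hR _ _ _ _ _ hMs h2 subset_union_left ?_ subset_union_left h3
      rw [hval, image_union, image_eq_of_fixes hσ, range_comp]
  obtain ⟨f, hf⟩ := hex.choice
  obtain ⟨a', ha'⟩ := hM.exists_satisfies (hM.mk_union_range_lt hMsκ hℕβ (flatSeq I)) hα (U.map f)
  have ha'a : EqTpOver L Ms a' a := by
    refine (ha'.mono subset_union_left).eqTpOver_of_eventually ?_
    rw [Ultrafilter.coe_map, eventually_map]
    filter_upwards [hf] with g hg using hg.2.1.trans hg.1
  have hpair : ∀ i, EqTpOver L Ms (Sum.elim a' (I i)) (Sum.elim a b) := by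
    intro i
    refine eqTpOver_iff.2 fun T hT => ?_
    have hfib : ∀ {D : Set 𝕄} {x : β → 𝕄}, range x ⊆ D → Ms ⊆ D →
        D.Definable L {g : α → 𝕄 | Sum.elim g x ∈ T} := by
      intro D x hx hD
      refine definable_preimage (hT.mono hD) (fun g => Sum.elim g x) ?_
      rintro (k | k)
      · exact Or.inl ⟨k, fun _ => rfl⟩
      · exact Or.inr ⟨x k, hx ⟨k, rfl⟩, fun _ => rfl⟩
    have hIi : range (I i) ⊆ Ms ∪ range (flatSeq I) := by
      rintro _ ⟨j, rfl⟩
      exact Or.inr ⟨(i, j), rfl⟩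
    refine (ha' _ (hfib hIi subset_union_left)).trans (Iff.trans ?_
      (hU _ (hfib subset_union_right subset_union_left)).symm)
    rw [Ultrafilter.mem_map]
    refine eventually_congr ?_
    filter_upwards [hf] with g hg using eqTpOver_iff.1 (hg.2.2.1 i) T hT
  have hcl : LeftClosure R Ms a' (range (flatSeq I)) := by
    refine ⟨U.map f, ha', ?_⟩
    rw [Ultrafilter.coe_map, eventually_map]
    filter_upwards [hf] with g hg
    exact ⟨(hg.2.1.trans hg.1).trans ha'a.symm, hg.2.2.2⟩
  obtain ⟨τ, hτ, rfl⟩ := hM.exists_equiv hMsκ hα ha'a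
  refine ⟨fun i => (⇑τ) ∘ I i, eqTpOver_of_fixes hτ (flatSeq I), ?_, fun i => ?_⟩
  · rw [leftClosure_range_iff hR hMs, hrange]
    have := hcl.map_equiv hRinv τ
    rw [image_eq_of_fixes hτ, ← range_comp] at this
    exact this
  · refine EqTpOver.of_sumElim (.trans ?_ (hpair i))
    rw [← Sum.comp_elim]
    exact eqTpOver_of_fixes hτ _

theorem goodRel_leftClosure (hM : IsMonster L 𝕄 κ) (hR : GoodRel R κ) :
    GoodRel R.leftClosure κ :=
  have ⟨hH, hinv, hmono, hex, hext, hchain⟩ := hR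
  ⟨leftClosure_strongerThanH hH, leftClosure_invariant hinv, leftClosure_mono hmono,
    leftClosure_existence hex, leftClosure_rightExt hM hmono hext,
    leftClosure_coheirChain hM hmono hinv hchain⟩

end IndRel

/-- `⫝^CK` contains its own left closure. -/
theorem IsCK.rel_of_leftClosure {R : IndRel L 𝕄} {κ : Cardinal.{u}} (hR : IsCK R κ)
    (hM : IsMonster L 𝕄 κ) {Ms : Set 𝕄} (hMs : IsElemSubmodel L Ms) {α : Type v} {a : α → 𝕄}
    {B : Set 𝕄} (h : LeftClosure R Ms a B) : R.rel (range a) Ms B :=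
  hR.2 _ (IndRel.goodRel_leftClosure hM hR.1) _ _ _
    ((IndRel.leftClosure_range_iff hR.1.2.2.1 hMs).2 h)

/-! ### Heirs of the identity -/

/-- There is an ultrafilter on self-maps of `𝕄`, concentrating on automorphisms fixing `Ms`,
whose average type restricts on every small tuple to a canonical global type. -/
theorem IsCK.exists_ultrafilter {R : IndRel L 𝕄} {κ : Cardinal.{u}} (hR : IsCK R κ)
    (hM : IsMonster L 𝕄 κ) {Ms : Set 𝕄} (hMs : IsElemSubmodel L Ms)
    (hMsκ : Cardinal.mk Ms < κ) :
    ∃ W : Ultrafilter (𝕄 → 𝕄), Satisfies L W Ms id ∧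
      ∀ (γ : Type u), Cardinal.mk γ < κ → ∀ a : γ → 𝕄,
        IsCanonicalGlobal R κ Ms (GlobalType.ofUltrafilter (L := L) (W.map fun f => f ∘ a)) := by
  obtain ⟨⟨-, -, hmono, hexist, -, -⟩, -⟩ := id hR
  let J := {s : Set 𝕄 // Cardinal.mk s < κ}
  have hdir : IsDirectedOrder (J × J) := ⟨fun s t =>
    ⟨(⟨s.1.1 ∪ t.1.1, hM.mk_union_lt s.1.2 t.1.2⟩, ⟨s.2.1 ∪ t.2.1, hM.mk_union_lt s.2.2 t.2.2⟩),
      ⟨subset_union_left, subset_union_left⟩, ⟨subset_union_right, subset_union_right⟩⟩⟩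
  have hne : Nonempty J := ⟨⟨Ms, hMsκ⟩⟩
  have hσ : ∀ j : J × J, ∃ σ : 𝕄 ≃[L] 𝕄, (∀ x ∈ Ms, σ x = x) ∧
      R.rel (Ms ∪ j.2.1) Ms (Ms ∪ σ '' j.1.1) := by
    rintro ⟨⟨A, hA⟩, ⟨B, hB⟩⟩
    obtain ⟨B', hB', h⟩ := hexist Ms hMs hMsκ B A hB hA (↑) (↑)
    obtain ⟨σ, hσ, hσB⟩ := hM.exists_equiv hMsκ hB hB'
    refine ⟨σ, hσ, ?_⟩
    have := hR.1.2.1 σ _ _ _ h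
    rwa [image_union, image_union, image_eq_of_fixes hσ, ← range_comp, hσB, Subtype.range_coe,
      Subtype.range_coe] at this
  choose f hf hfR using hσ
  let V : Ultrafilter (J × J) := Ultrafilter.of atTop
  have hV : ∀ {P : J × J → Prop}, (∀ᶠ j in atTop, P j) → ∀ᶠ j in V, P j :=
    fun h => Ultrafilter.of_le _ h
  have hfix : ∀ {γ : Type u} (a : γ → 𝕄) (j), EqTpOver L Ms ((⇑(f j)) ∘ a) a :=
    fun a j => eqTpOver_of_fixes (hf j) a
  refine ⟨V.map fun j => ⇑(f j), fun S hS => ?_, fun γ hγ a β hβ b c hc => ?_⟩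
  · rw [Ultrafilter.mem_map]
    have h : ∀ j, (id ∈ S ↔ ⇑(f j) ∈ S) := fun j => (eqTpOver_iff.1 (hfix id j) S hS).symm
    by_cases hid : id ∈ S
    · exact iff_of_true hid (Filter.univ_mem' fun j => (h j).1 hid)
    · refine iff_of_false hid fun hn => ?_
      obtain ⟨j, hj⟩ := V.nonempty_of_mem hn
      exact hid ((h j).2 hj)
  rw [realizesType_ofUltrafilter, Ultrafilter.map_map] at hc
  have hca : EqTpOver L Ms c a := by
    refine (hc.mono subset_union_left).eqTpOver_of_eventually ?_
    rw [Ultrafilter.coe_map, eventually_map]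
    exact Eventually.of_forall fun j => hfix a j
  have hτ : ∀ j, ∃ τ : 𝕄 ≃[L] 𝕄, (∀ x ∈ Ms, τ x = x) ∧ (⇑τ) ∘ ((⇑(f j)) ∘ a) = c :=
    fun j => hM.exists_equiv hMsκ hγ ((hfix a j).trans hca.symm)
  choose τ hτ hτc using hτ
  refine hR.rel_of_leftClosure hM hMs ⟨V.map fun j => (⇑(τ j)) ∘ b, fun S hS => ?_, ?_⟩
  · obtain ⟨T, hT, hST⟩ := definable_fiber c hS
    have hdef : (Ms ∪ range b).Definable L {g : γ → 𝕄 | Sum.elim g b ∈ T} := by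
      refine definable_preimage (hT.mono subset_union_left) (fun g => Sum.elim g b) ?_
      rintro (k | k)
      · exact Or.inl ⟨k, fun _ => rfl⟩
      · exact Or.inr ⟨b k, Or.inr ⟨k, rfl⟩, fun _ => rfl⟩
    rw [hST]
    refine (hc _ hdef).trans ?_
    rw [Ultrafilter.mem_map, Ultrafilter.mem_map]
    refine eventually_congr (Eventually.of_forall fun j => ?_)
    change Sum.elim ((⇑(f j)) ∘ a) b ∈ T ↔ (⇑(τ j)) ∘ b ∈ S
    rw [hST, ← hτc j, ← Sum.comp_elim]
    exact (mem_iff_of_fixes (hτ j) hT _).symm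
  · rw [Ultrafilter.coe_map, eventually_map]
    have hlarge : ∀ᶠ j : J × J in V, range a ⊆ j.1.1 ∧ range b ⊆ j.2.1 :=
      hV ((eventually_ge_atTop (⟨⟨range a, Cardinal.mk_range_le.trans_lt hγ⟩,
        ⟨range b, Cardinal.mk_range_le.trans_lt hβ⟩⟩ : J × J)).mono fun j hj => hj)
    filter_upwards [hlarge] with j ⟨hja, hjb⟩
    refine ⟨eqTpOver_of_fixes (hτ j) b, ?_⟩
    have h := hR.1.2.1 (τ j) _ _ _ (hfR j)
    rw [image_eq_of_fixes (hτ j)] at h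
    refine hmono _ _ _ _ _ hMs h subset_union_left ?_ subset_union_left ?_
    · rw [image_union, image_eq_of_fixes (hτ j), range_comp]
      exact union_subset_union_right _ (image_mono hjb)
    · rw [image_union, image_eq_of_fixes (hτ j), ← hτc j, range_comp, range_comp]
      exact union_subset_union_right _ (image_mono (image_mono hja))

end Auxiliary


/-- **Lemma 5.5.** Every type `p(x) = tp(b₀/M)` over `M` has a global
extension `q(x)` such that for all tuples `b`, if `c ⊨ q|_{Mb}` then for any
tuple `a` there is `a' ≡_{Mc} a` such that `tp(a'c/Mb)` extends to a canonical
coheir of `tp(a'c/M)` (and `tp(a'c/M) = tp(ac/M)`).  In particular `q` is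
itself a canonical coheir of `p`. -/
theorem strong_canonical_coheir_exists (L : FirstOrder.Language.{u, u}) (𝕄 : Type u)
    [L.Structure 𝕄] (κ : Cardinal.{u}) (hmonster : IsMonster L 𝕄 κ)
    (R : IndRel L 𝕄) (hCK : IsCK R κ)
    (Ms : Set 𝕄) (hMs : IsElemSubmodel L Ms) (hMssmall : Cardinal.mk Ms < κ)
    (α : Type u) (hα : Cardinal.mk α < κ) (b₀ : α → 𝕄) :
    ∃ q : GlobalType L 𝕄 α, ExtendsTpOver q Ms b₀ ∧
      (∀ (β : Type u), Cardinal.mk β < κ → ∀ (b : β → 𝕄) (c : α → 𝕄),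
        RealizesType q c (Ms ∪ Set.range b) →
        ∀ (γ : Type u), Cardinal.mk γ < κ → ∀ (a : γ → 𝕄),
          ∃ a' : γ → 𝕄, EqTpOver L (Ms ∪ Set.range c) a' a ∧
            EqTpOver L Ms (Sum.elim a' c) (Sum.elim a c) ∧
            ∃ q' : GlobalType L 𝕄 (γ ⊕ α), IsCanonicalGlobal R κ Ms q' ∧
              ExtendsTpOver q' Ms (Sum.elim a' c) ∧
              ExtendsTpOver q' (Ms ∪ Set.range b) (Sum.elim a' c)) ∧
      IsCanonicalGlobal R κ Ms q := by
  obtain ⟨W, hWid, hW⟩ := hCK.exists_ultrafilter hmonster hMs hMssmall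
  refine ⟨GlobalType.ofUltrafilter (W.map fun f => f ∘ b₀),
    extendsTpOver_ofUltrafilter (hWid.comp b₀), fun β hβ b c hc γ hγ a => ?_, hW α hα b₀⟩
  rw [realizesType_ofUltrafilter] at hc
  have hcb : EqTpOver L Ms c b₀ := (hc.mono Set.subset_union_left).eqTpOver (hWid.comp b₀)
  obtain ⟨σ, hσ, hσc⟩ := hmonster.exists_equiv hMssmall hα hcb
  have hMsb := hmonster.mk_union_range_lt hMssmall hβ b
  have hγα := hmonster.mk_sum_lt hγ hα
  obtain ⟨d, hd⟩ := hmonster.exists_satisfies hMsb hγα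
    (W.map fun f => f ∘ Sum.elim ((⇑σ) ∘ a) b₀)
  have hdc : EqTpOver L (Ms ∪ Set.range b) (d ∘ Sum.inr) c := (hd.comp Sum.inr).eqTpOver hc
  obtain ⟨τ, hτ, hτd⟩ := hmonster.exists_equiv hMsb hα hdc
  have hd' : Sum.elim ((⇑τ) ∘ d ∘ Sum.inl) c = (⇑τ) ∘ d := by
    rw [← hτd, ← Sum.comp_elim, Sum.elim_comp_inl_inr]
  have hsat : Satisfies L (W.map fun f => f ∘ Sum.elim ((⇑σ) ∘ a) b₀) (Ms ∪ Set.range b)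
      (Sum.elim ((⇑τ) ∘ d ∘ Sum.inl) c) := by
    rw [hd']
    exact hd.of_eqTpOver (eqTpOver_of_fixes hτ d)
  have hsat' := hsat.mono (Set.subset_union_left (s := Ms))
  have heq : EqTpOver L Ms (Sum.elim ((⇑τ) ∘ d ∘ Sum.inl) c) (Sum.elim a c) := by
    refine (hsat'.eqTpOver (hWid.comp (Sum.elim ((⇑σ) ∘ a) b₀))).trans ?_
    rw [Function.id_comp, ← hσc, ← Sum.comp_elim]
    exact eqTpOver_of_fixes hσ _
  exact ⟨_, heq.sumElim_comm.of_sumElim, heq, _, hW _ hγα _,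
    extendsTpOver_ofUltrafilter hsat', extendsTpOver_ofUltrafilter hsat⟩

end NSOP2Paper
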